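/- Let k ≥ 2 be a natural number. For every ε > 0 there is a constant C(k,ε) such that for all real X ≥ 1 one has ∫_0^1 |g_k(α;X)|^{2^k} dα ≤ C(k,ε) · X^{2^k − k + ε} (Hua's inequality). -/

import Mathlib

/-- The exponential sum `g k β X = ∑_{1 ≤ x ≤ X} e(β x^k)`. -/
noncomputable def gsum (k : ℕ) (β : ℝ) (X : ℝ) : ℂ :=
  ∑ x ∈ Finset.Icc 1 ⌊X⌋₊,
    Complex.exp (2 * (Real.pi : ℂ) * Complex.I * ((β * (x : ℝ) ^ k : ℝ) : ℂ))

noncomputable def huaE (α : ℝ) (m : ℤ) : ℂ :=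
  Complex.exp (2 * (Real.pi : ℂ) * Complex.I * ((α * (m : ℝ) : ℝ) : ℂ))

lemma huaE_add (α : ℝ) (m n : ℤ) : huaE α (m + n) = huaE α m * huaE α n := by
  unfold huaE
  rw [← Complex.exp_add]
  congr 1
  push_cast
  ring

lemma huaE_zero (m : ℤ) : huaE 0 m = 1 := by
  simp [huaE]

lemma huaE_zero' (α : ℝ) : huaE α 0 = 1 := by
  simp [huaE]

lemma huaE_conj (α : ℝ) (m : ℤ) : (starRingEnd ℂ) (huaE α m) = huaE α (-m) := by
  unfold huaE
  rw [← Complex.exp_conj]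
  congr 1
  simp [map_ofNat]

lemma huaE_cont (m : ℤ) : Continuous (fun α => huaE α m) := by
  unfold huaE
  fun_prop

lemma huaE_int (m : ℤ) : ∫ α in (0:ℝ)..1, huaE α m = if m = 0 then 1 else 0 := by
  split_ifs with h
  · subst h
    simp [huaE]
  · have hc : (2 * (Real.pi : ℂ) * Complex.I * m) ≠ 0 := by
      have := Real.pi_ne_zero
      simp [h, this]
    have h2 := integral_exp_mul_complex (a := 0) (b := 1) hc
    have h3 : ∀ α : ℝ, huaE α m = Complex.exp ((2 * (Real.pi : ℂ) * Complex.I * m) * α) := by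
      intro α
      unfold huaE
      congr 1
      push_cast
      ring
    simp_rw [h3, h2]
    have h4 := Complex.exp_int_mul_two_pi_mul_I m
    rw [mul_comm] at h4
    simp [h4]

noncomputable def huaS (α : ℝ) : Multiset ℤ →+ ℂ :=
  Multiset.sumAddMonoidHom.comp (Multiset.mapAddMonoidHom (huaE α))

lemma huaS_apply (α : ℝ) (M : Multiset ℤ) : huaS α M = (M.map (huaE α)).sum := rfl

lemma huaS_cons (α : ℝ) (a : ℤ) (M : Multiset ℤ) :
    huaS α (a ::ₘ M) = huaE α a + huaS α M := by
  simp [huaS_apply]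

lemma huaS_cont (M : Multiset ℤ) : Continuous (fun α => huaS α M) := by
  induction M using Multiset.induction with
  | empty => simpa using continuous_const
  | cons a M ih =>
    simp_rw [huaS_cons]
    exact (huaE_cont a).add ih

lemma huaS_zero (M : Multiset ℤ) : huaS 0 M = (Multiset.card M : ℂ) := by
  induction M using Multiset.induction with
  | empty => simp
  | cons a M ih => rw [huaS_cons, ih, huaE_zero]; simp; ring

lemma huaS_shift (α : ℝ) (a : ℤ) (M : Multiset ℤ) :
    huaS α (M.map (fun m => a + m)) = huaE α a * huaS α M := by
  induction M using Multiset.induction with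
  | empty => simp
  | cons b M ih => rw [Multiset.map_cons, huaS_cons, huaS_cons, ih, huaE_add]; ring

lemma huaS_mul (M L : Multiset ℤ) : ∃ T, ∀ α, huaS α M * huaS α L = huaS α T := by
  induction M using Multiset.induction with
  | empty => exact ⟨0, by simp⟩
  | cons a M ih =>
    obtain ⟨T, hT⟩ := ih
    refine ⟨L.map (fun m => a + m) + T, fun α => ?_⟩
    rw [huaS_cons, map_add, huaS_shift, ← hT]
    ring

lemma huaS_pow (M : Multiset ℤ) (n : ℕ) : ∃ T, ∀ α, huaS α M ^ n = huaS α T := by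
  induction n with
  | zero => exact ⟨{0}, fun α => by simp [huaS_apply, huaE_zero']⟩
  | succ n ih =>
    obtain ⟨T, hT⟩ := ih
    obtain ⟨U, hU⟩ := huaS_mul T M
    exact ⟨U, fun α => by rw [pow_succ, hT, hU]⟩

lemma huaS_int (M : Multiset ℤ) : ∫ α in (0:ℝ)..1, huaS α M = (M.count 0 : ℂ) := by
  induction M using Multiset.induction with
  | empty => simp
  | cons a M ih =>
    simp_rw [huaS_cons]
    rw [intervalIntegral.integral_add ((huaE_cont a).intervalIntegrable _ _)
      ((huaS_cont M).intervalIntegrable _ _), ih, huaE_int, Multiset.count_cons]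
    push_cast
    simp only [eq_comm (a := a)]
    ring

lemma count_shift (a : ℤ) (L : Multiset ℤ) :
    (L.map (fun m => a + m)).count 0 = L.count (-a) := by
  have h := Multiset.count_map_eq_count' (fun m => a + m) L (add_right_injective a) (-a)
  simpa using h

lemma huaS_int_mul (T D : Multiset ℤ) : ∫ α in (0:ℝ)..1, huaS α T * huaS α D =
    ((T.map (fun t => D.count (-t))).sum : ℕ) := by
  induction T using Multiset.induction with
  | empty => simp
  | cons a T ih =>
    simp_rw [huaS_cons, add_mul]
    have c1 : Continuous (fun α => huaE α a * huaS α D) := (huaE_cont a).mul (huaS_cont D)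
    have c2 : Continuous (fun α => huaS α T * huaS α D) := (huaS_cont T).mul (huaS_cont D)
    rw [intervalIntegral.integral_add (c1.intervalIntegrable _ _) (c2.intervalIntegrable _ _), ih]
    simp_rw [← huaS_shift]
    rw [huaS_int, count_shift]
    simp

lemma sum_count_le (T D : Multiset ℤ) (c0 c1 : ℕ) (h0 : D.count 0 ≤ c0)
    (h1 : ∀ m, m ≠ 0 → D.count m ≤ c1) :
    (T.map (fun t => D.count (-t))).sum ≤ T.count 0 * c0 + Multiset.card T * c1 := by
  induction T using Multiset.induction with
  | empty => simp
  | cons a T ih =>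
    rw [Multiset.map_cons, Multiset.sum_cons, Multiset.count_cons, Multiset.card_cons]
    by_cases h : a = 0
    · subst h
      simp only [neg_zero, if_true]
      nlinarith
    · have := h1 (-a) (by simpa using h)
      rw [if_neg (fun h' => h h'.symm)]
      nlinarith

noncomputable def huaD (N : ℕ) : ℕ → (ℤ → ℤ) → Finset ℤ → Multiset ℤ
  | 0, φ, A => A.val.map φ
  | j + 1, φ, A => ∑ h ∈ Finset.Icc (-(N:ℤ)) N,
      huaD N j (fun x => φ (x + h) - φ x) (A.filter (fun x => x + h ∈ A))

lemma huaD_sq (N : ℕ) (φ : ℤ → ℤ) (A : Finset ℤ) (hA : A ⊆ Finset.Icc 1 (N:ℤ)) (α : ℝ) :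
    ((‖huaS α (A.val.map φ)‖ ^ 2 : ℝ) : ℂ) = huaS α (huaD N 1 φ A) := by
  have e : ∀ (B : Finset ℤ) (ψ : ℤ → ℤ), huaS α (B.val.map ψ) = ∑ x ∈ B, huaE α (ψ x) := by
    intro B ψ
    rw [huaS_apply, Multiset.map_map]; rfl
  push_cast
  rw [← Complex.conj_mul', huaD, map_sum]
  simp only [huaD, e, map_sum, huaE_conj, Finset.sum_mul_sum, ← huaE_add, Finset.sum_filter]
  rw [Finset.sum_comm (s := Finset.Icc _ _)]
  refine Finset.sum_congr rfl fun x hx => ?_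
  rw [← Finset.sum_filter]
  refine Finset.sum_bij' (fun y _ => y - x) (fun h _ => x + h) ?_ ?_ ?_ ?_ ?_
  · intro y hy
    have h1 := Finset.mem_Icc.1 (hA hx)
    have h2 := Finset.mem_Icc.1 (hA hy)
    simp only [Finset.mem_filter, Finset.mem_Icc]
    refine ⟨by omega, by simpa using hy⟩
  · intro h hh
    exact (Finset.mem_filter.1 hh).2
  · intros; ring
  · intros; ring
  · intro y hy
    congr 1
    rw [show x + (y - x) = y by ring]; ring

lemma huaD_weyl (N : ℕ) (j : ℕ) : ∀ (φ : ℤ → ℤ) (A : Finset ℤ) (_ : A ⊆ Finset.Icc 1 (N:ℤ)) (α : ℝ),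
    ‖huaS α (A.val.map φ)‖ ^ (2 ^ (j+1)) ≤
      (2 * N + 1 : ℝ) ^ (2 ^ (j+1) - (j+1) - 1) * (huaS α (huaD N (j+1) φ A)).re := by
  induction j with
  | zero =>
    intro φ A hA α
    rw [zero_add, ← huaD_sq N φ A hA α, Complex.ofReal_re]
    simp
  | succ j ih =>
    intro φ A hA α
    have hsq := huaD_sq N φ A hA α
    have hn : ‖huaS α (A.val.map φ)‖ ^ 2 = ‖huaS α (huaD N 1 φ A)‖ := by
      rw [← hsq, Complex.norm_real, Real.norm_of_nonneg (by positivity)]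
    set F : ℤ → ℝ := fun h => ‖huaS α ((A.filter (fun x => x + h ∈ A)).val.map
      (fun x => φ (x + h) - φ x))‖ with hF
    have h1 : ‖huaS α (A.val.map φ)‖ ^ 2 ≤ ∑ h ∈ Finset.Icc (-(N:ℤ)) N, F h := by
      rw [hn, huaD, map_sum]
      exact norm_sum_le _ _
    have hcard : ((Finset.Icc (-(N:ℤ)) N).card : ℝ) = 2 * N + 1 := by
      rw [Int.card_Icc]
      have : ((N:ℤ) + 1 - -(N:ℤ)).toNat = 2 * N + 1 := by omega
      rw [this]; push_cast; ring
    have h2 := pow_sum_div_card_le_sum_pow (s := Finset.Icc (-(N:ℤ)) N) (f := F)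
      (fun i _ => norm_nonneg _) (2 ^ (j+1) - 1)
    have hp : 0 < 2 ^ (j+1) := by positivity
    rw [hcard, div_le_iff₀ (by positivity), Nat.sub_add_cancel hp] at h2
    have hlt : j + 1 < 2 ^ (j+1) := Nat.lt_two_pow_self
    calc ‖huaS α (A.val.map φ)‖ ^ (2 ^ (j+1+1))
        = (‖huaS α (A.val.map φ)‖ ^ 2) ^ (2 ^ (j+1)) := by rw [← pow_mul]; congr 1; ring
      _ ≤ (∑ h ∈ Finset.Icc (-(N:ℤ)) N, F h) ^ (2 ^ (j+1)) := by gcongr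
      _ ≤ (∑ h ∈ Finset.Icc (-(N:ℤ)) N, F h ^ (2 ^ (j+1))) * (2 * N + 1 : ℝ) ^ (2 ^ (j+1) - 1) := h2
      _ ≤ (∑ h ∈ Finset.Icc (-(N:ℤ)) N, (2 * N + 1 : ℝ) ^ (2 ^ (j+1) - (j+1) - 1) *
            (huaS α (huaD N (j+1) (fun x => φ (x + h) - φ x) (A.filter (fun x => x + h ∈ A)))).re)
            * (2 * N + 1 : ℝ) ^ (2 ^ (j+1) - 1) := by
          gcongr with h hh
          exact ih _ _ ((Finset.filter_subset _ _).trans hA) α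
      _ = _ := by
          rw [← Finset.mul_sum, ← Complex.re_sum, ← map_sum]
          rw [show huaD N (j+1+1) φ A = ∑ h ∈ Finset.Icc (-(N:ℤ)) N,
            huaD N (j+1) (fun x => φ (x + h) - φ x) (A.filter (fun x => x + h ∈ A)) from rfl]
          rw [mul_right_comm, ← pow_add]
          congr 2
          rw [pow_succ 2 (j+1)]
          omega

lemma huaD_dvd (N : ℕ) (d : ℤ) (j : ℕ) : ∀ (φ : ℤ → ℤ) (A : Finset ℤ) (_ : ∀ x, d ∣ φ x),
    ∀ m ∈ huaD N j φ A, d ∣ m := by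
  induction j with
  | zero =>
    intro φ A h m hm
    obtain ⟨x, _, rfl⟩ := Multiset.mem_map.1 hm
    exact h x
  | succ j ih =>
    intro φ A h m hm
    rw [huaD, Multiset.mem_sum] at hm
    obtain ⟨i, _, hi⟩ := hm
    exact ih _ _ (fun x => dvd_sub (h _) (h _)) m hi

lemma huaD_bd (N : ℕ) (j : ℕ) : ∀ (B : ℤ) (φ : ℤ → ℤ) (A : Finset ℤ) (_ : ∀ x ∈ A, |φ x| ≤ B),
    ∀ m ∈ huaD N j φ A, |m| ≤ 2 ^ j * B := by
  induction j with
  | zero =>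
    intro B φ A h m hm
    obtain ⟨x, hx, rfl⟩ := Multiset.mem_map.1 hm
    simpa using h x hx
  | succ j ih =>
    intro B φ A h m hm
    rw [huaD, Multiset.mem_sum] at hm
    obtain ⟨i, _, hi⟩ := hm
    have := ih (2 * B) _ _ (fun x hx => ?_) m hi
    · rw [pow_succ]; linarith
    · rw [Finset.mem_filter] at hx
      have h1 := h _ hx.1
      have h2 := h _ hx.2
      rw [abs_le] at *
      constructor <;> linarith

lemma huaD_card (N : ℕ) (j : ℕ) : ∀ (φ : ℤ → ℤ) (A : Finset ℤ),
    Multiset.card (huaD N j φ A) ≤ A.card * (2 * N + 1) ^ j := by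
  induction j with
  | zero => intro φ A; simp [huaD]
  | succ j ih =>
    intro φ A
    rw [huaD, Multiset.card_sum]
    calc _ ≤ ∑ h ∈ Finset.Icc (-(N:ℤ)) N, A.card * (2 * N + 1) ^ j := by
          refine Finset.sum_le_sum fun h _ => (ih _ _).trans ?_
          gcongr
          exact Finset.filter_subset _ _
      _ = _ := by
          rw [Finset.sum_const, Int.card_Icc,
            show ((N:ℤ) + 1 - -(N:ℤ)).toNat = 2 * N + 1 by omega, smul_eq_mul]
          ring

open Polynomial in
lemma taylor_deg (P : ℤ[X]) (h : ℤ) (hh : h ≠ 0) (j : ℕ) (hP : j + 1 < P.natDegree) :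
    j < (taylor h P - P).natDegree := by
  obtain ⟨n, hn⟩ : ∃ n, P.natDegree = n + 1 := ⟨P.natDegree - 1, by omega⟩
  have hlc : P.coeff (n + 1) ≠ 0 := by
    rw [← hn]
    apply leadingCoeff_ne_zero.2
    rintro rfl
    simp at hP
  have hc : (taylor h P - P).coeff n = (n + 1) * P.coeff (n + 1) * h := by
    rw [coeff_sub, taylor_coeff, hasseDeriv_apply, Polynomial.sum_over_range _ (by simp), hn,
      eval_finsetSum, Finset.sum_range_succ, Finset.sum_range_succ, Finset.sum_eq_zero]
    · simp
    · intro i hi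
      rw [Nat.choose_eq_zero_of_lt (Finset.mem_range.1 hi)]
      simp
  have : n ≤ (taylor h P - P).natDegree := by
    apply le_natDegree_of_ne_zero
    rw [hc]
    have : (n + 1 : ℤ) ≠ 0 := by positivity
    simp [*]
  omega

open Polynomial in
lemma taylor_deg_le (P : ℤ[X]) (h : ℤ) : (taylor h P - P).natDegree ≤ P.natDegree := by
  refine (natDegree_sub_le _ _).trans ?_
  simp

open Polynomial in
lemma count_base (P : ℤ[X]) (hP : 0 < P.natDegree) (A : Finset ℤ) (m : ℤ) :
    (A.val.map (fun x => P.eval x)).count m ≤ P.natDegree := by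
  have hd : 0 < P.degree := natDegree_pos_iff_degree_pos.1 hP
  refine le_trans ?_ (card_roots_sub_C' (p := P) (a := m) hd)
  rw [Multiset.count_map]
  apply Multiset.card_le_card
  rw [Multiset.le_iff_subset (A.nodup.filter _)]
  intro x hx
  have hx := (Multiset.mem_filter.1 hx).2
  rw [mem_roots_sub_C hd]
  exact hx.symm

open Polynomial in
lemma count_zero (N : ℕ) (d : ℕ) (j : ℕ) : ∀ (P : ℤ[X]) (_ : j < P.natDegree) (_ : P.natDegree ≤ d)
    (A : Finset ℤ) (_ : A ⊆ Finset.Icc 1 (N:ℤ)),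
    (huaD N j (fun x => P.eval x) A).count 0 ≤ (j + d) * (2 * N + 1) ^ j := by
  induction j with
  | zero =>
    intro P h1 h2 A _
    have := count_base P h1 A 0
    simp only [huaD]
    simp
    omega
  | succ j ih =>
    intro P h1 h2 A hA
    rw [huaD, Multiset.count_sum']
    have hAc : A.card ≤ N := by simpa using Finset.card_le_card hA
    have hmem : (0:ℤ) ∈ Finset.Icc (-(N:ℤ)) N := by simp
    rw [← Finset.add_sum_erase _ _ hmem]
    have key : ∀ h ∈ (Finset.Icc (-(N:ℤ)) N).erase 0,
        (huaD N j (fun x => P.eval (x + h) - P.eval x) (A.filter (fun x => x + h ∈ A))).count 0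
          ≤ (j + d) * (2 * N + 1) ^ j := by
      intro h hh
      have h0 : h ≠ 0 := (Finset.mem_erase.1 hh).1
      have := ih (taylor h P - P) (taylor_deg P h h0 j h1) ((taylor_deg_le P h).trans h2)
        (A.filter (fun x => x + h ∈ A)) ((Finset.filter_subset _ _).trans hA)
      simpa [taylor_eval] using this
    have h3 := Finset.sum_le_card_nsmul _ _ _ key
    rw [Finset.card_erase_of_mem hmem, Int.card_Icc,
            show ((N:ℤ) + 1 - -(N:ℤ)).toNat = 2 * N + 1 by omega, smul_eq_mul] at h3
    refine (add_le_add ((Multiset.count_le_card _ _).trans (huaD_card N j _ _)) h3).trans ?_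
    have h4 : (A.filter (fun x => x + 0 ∈ A)).card ≤ 2 * N + 1 :=
      (Finset.card_filter_le _ _).trans (by omega)
    calc _ ≤ (2 * N + 1) * (2 * N + 1) ^ j + (2 * N + 1) * ((j + d) * (2 * N + 1) ^ j) := by
          gcongr
          omega
      _ = _ := by ring

open Polynomial in
lemma count_ne (N : ℕ) (d : ℕ) (m : ℤ) (hm : m ≠ 0) (j : ℕ) :
    ∀ (P : ℤ[X]) (_ : j < P.natDegree) (_ : P.natDegree ≤ d) (A : Finset ℤ),
    (huaD N j (fun x => P.eval x) A).count m ≤ (2 * m.natAbs.divisors.card) ^ j * d := by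
  induction j with
  | zero =>
    intro P h1 h2 A
    have := count_base P h1 A m
    simp only [huaD]
    simp
    omega
  | succ j ih =>
    intro P h1 h2 A
    rw [huaD, Multiset.count_sum']
    set W : Finset ℤ := m.natAbs.divisors.image (fun n : ℕ => (n:ℤ)) ∪
      m.natAbs.divisors.image (fun n : ℕ => -(n:ℤ)) with hW
    have hWc : W.card ≤ 2 * m.natAbs.divisors.card := by
      refine (Finset.card_union_le _ _).trans ?_
      have h1 := Finset.card_image_le (s := m.natAbs.divisors) (f := fun n : ℕ => (n:ℤ))
      have h2 := Finset.card_image_le (s := m.natAbs.divisors) (f := fun n : ℕ => -(n:ℤ))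
      omega
    have hWm : ∀ h : ℤ, h ∣ m → h ∈ W := by
      intro h hd
      have : h.natAbs ∈ m.natAbs.divisors := by
        rw [Nat.mem_divisors]
        exact ⟨Int.natAbs_dvd_natAbs.2 hd, by simpa using hm⟩
      rw [hW, Finset.mem_union, Finset.mem_image, Finset.mem_image]
      rcases Int.natAbs_eq h with h' | h'
      · exact Or.inl ⟨_, this, h'.symm⟩
      · exact Or.inr ⟨_, this, h'.symm⟩
    have key : ∀ h : ℤ,
        (huaD N j (fun x => P.eval (x + h) - P.eval x) (A.filter (fun x => x + h ∈ A))).count m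
          ≤ if h ∈ W then (2 * m.natAbs.divisors.card) ^ j * d else 0 := by
      intro h
      by_cases hd : h ∣ m
      · rw [if_pos (hWm h hd)]
        have h0 : h ≠ 0 := by
          rintro rfl
          exact hm (zero_dvd_iff.1 hd)
        have := ih (taylor h P - P) (taylor_deg P h h0 j h1) ((taylor_deg_le P h).trans h2)
          (A.filter (fun x => x + h ∈ A))
        simpa [taylor_eval] using this
      · rw [Multiset.count_eq_zero_of_notMem]
        · exact Nat.zero_le _
        · intro hmem
          refine hd (huaD_dvd N h j _ _ (fun x => ?_) m hmem)
          simpa using sub_dvd_eval_sub (x + h) x P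
    refine (Finset.sum_le_sum fun h _ => key h).trans ?_
    rw [← Finset.sum_filter, Finset.sum_const, smul_eq_mul]
    calc _ ≤ (2 * m.natAbs.divisors.card) * ((2 * m.natAbs.divisors.card) ^ j * d) := by
          gcongr
          refine le_trans (Finset.card_le_card ?_) hWc
          intro x hx
          exact (Finset.mem_filter.1 hx).2
      _ = _ := by ring

lemma divisor_bound (δ : ℝ) (hδ : 0 < δ) : ∃ C : ℝ, 1 ≤ C ∧ ∀ n : ℕ, n ≠ 0 →
    (n.divisors.card : ℝ) ≤ C * (n : ℝ) ^ δ := by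
  have hl : 0 < Real.log 2 := Real.log_pos (by norm_num)
  set K : ℝ := 1 + 1 / (δ * Real.log 2) with hK
  have hK1 : 1 ≤ K := by
    have : 0 ≤ 1 / (δ * Real.log 2) := by positivity
    linarith
  set Q : ℕ := ⌈(2:ℝ) ^ (1 / δ)⌉₊ with hQ
  refine ⟨K ^ Q, one_le_pow₀ hK1, fun n hn => ?_⟩
  have loc : ∀ p ∈ n.primeFactors, ((n.factorization p + 1 : ℕ) : ℝ) ≤
      (if p < Q then K else 1) * ((p:ℝ) ^ n.factorization p) ^ δ := by
    intro p hp
    have hp2 : (2:ℝ) ≤ p := by exact_mod_cast (Nat.prime_of_mem_primeFactors hp).two_le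
    set a := n.factorization p
    have hsw : ((p:ℝ) ^ a) ^ δ = ((p:ℝ) ^ δ) ^ a := by
      rw [← Real.rpow_natCast, ← Real.rpow_natCast, ← Real.rpow_mul (by positivity),
        ← Real.rpow_mul (by positivity), mul_comm]
    rw [hsw]
    push_cast
    split_ifs with hpQ
    · have h1 : 1 + δ * Real.log 2 ≤ (p:ℝ) ^ δ := by
        calc 1 + δ * Real.log 2 ≤ Real.exp (δ * Real.log 2) := by
              linarith [Real.add_one_le_exp (δ * Real.log 2)]
          _ = (2:ℝ) ^ δ := by rw [Real.rpow_def_of_pos (by norm_num), mul_comm]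
          _ ≤ _ := by gcongr
      have h2 := one_add_mul_le_pow (a := δ * Real.log 2) (by nlinarith [mul_pos hδ hl]) a
      have h3 : (1 + δ * Real.log 2) ^ a ≤ ((p:ℝ) ^ δ) ^ a := by
        gcongr
      have hpos := mul_pos hδ hl
      have h4 : (a:ℝ) + 1 ≤ K * (1 + a * (δ * Real.log 2)) := by
        have : K * (1 + a * (δ * Real.log 2)) = 1 + a + a * (δ * Real.log 2) + 1 / (δ * Real.log 2) := by
          rw [hK]; field_simp; ring
        rw [this]
        have : 0 ≤ a * (δ * Real.log 2) + 1 / (δ * Real.log 2) := by positivity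
        linarith
      refine h4.trans ?_
      gcongr
      exact h2.trans h3
    · have h1 : (2:ℝ) ≤ (p:ℝ) ^ δ := by
        have : (2:ℝ) ^ (1/δ) ≤ p := by
          refine (Nat.le_ceil _).trans ?_
          exact_mod_cast not_lt.1 hpQ
        calc (2:ℝ) = ((2:ℝ) ^ (1/δ)) ^ δ := by
              rw [← Real.rpow_mul (by norm_num)]; field_simp; simp
          _ ≤ _ := by gcongr
      have h2 := one_add_mul_le_pow (a := (1:ℝ)) (by norm_num) a
      have h3 : (1 + 1 : ℝ) ^ a ≤ ((p:ℝ) ^ δ) ^ a := by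
        gcongr; linarith
      linarith
  rw [Nat.card_divisors hn]
  rw [Nat.cast_prod]
  refine (Finset.prod_le_prod (fun _ _ => by positivity) loc).trans ?_
  rw [Finset.prod_mul_distrib, Real.finsetProd_rpow _ _ (fun _ _ => by positivity)]
  have hprod : ∏ p ∈ n.primeFactors, (p:ℝ) ^ n.factorization p = n := by
    conv_rhs => rw [← Nat.prod_factorization_pow_eq_self hn]
    rw [Finsupp.prod, Nat.support_factorization]
    push_cast
    rfl
  rw [hprod]
  gcongr
  rw [Finset.prod_ite]
  simp only [Finset.prod_const, one_pow, mul_one]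
  apply pow_le_pow_right₀ hK1
  calc _ ≤ (Finset.range Q).card := by
        apply Finset.card_le_card
        intro p hp
        simpa using (Finset.mem_filter.1 hp).2
    _ = Q := by simp

lemma int_of_trig (f : ℝ → ℝ) (T : Multiset ℤ) (h : ∀ α, ((f α : ℝ) : ℂ) = huaS α T) :
    ∫ α in (0:ℝ)..1, f α = (T.count 0 : ℝ) := by
  have h1 := huaS_int T
  simp_rw [← h] at h1
  rw [intervalIntegral.integral_ofReal] at h1
  exact_mod_cast h1

/-- The inductive step in abstract form. -/
lemma hua_step (N : ℕ) (j : ℕ) (φ : ℤ → ℤ) (A : Finset ℤ) (hA : A ⊆ Finset.Icc 1 (N:ℤ)) (c0 c1 : ℕ)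
    (h0 : (huaD N (j+1) φ A).count 0 ≤ c0)
    (h1 : ∀ m, m ≠ 0 → (huaD N (j+1) φ A).count m ≤ c1) :
    ∫ α in (0:ℝ)..1, ‖huaS α (A.val.map φ)‖ ^ (2 ^ (j+2)) ≤
      (2 * N + 1 : ℝ) ^ (2 ^ (j+1) - (j+1) - 1) *
        ((∫ α in (0:ℝ)..1, ‖huaS α (A.val.map φ)‖ ^ (2 ^ (j+1))) * c0 + (N:ℝ) ^ (2 ^ (j+1)) * c1) := by
  obtain ⟨T, hT⟩ := huaS_pow (huaD N 1 φ A) (2 ^ j)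
  have hT' : ∀ α, ((‖huaS α (A.val.map φ)‖ ^ (2 ^ (j+1)) : ℝ) : ℂ) = huaS α T := by
    intro α
    rw [← hT, ← huaD_sq N φ A hA α, ← Complex.ofReal_pow, ← pow_mul]
    congr 3
    ring
  have hAc : A.card ≤ N := by simpa using Finset.card_le_card hA
  have hcard : (Multiset.card T : ℝ) ≤ (N:ℝ) ^ (2 ^ (j+1)) := by
    have h2 := hT' 0
    rw [huaS_zero, huaS_zero] at h2
    have h3 : ((A.card : ℝ)) ^ (2 ^ (j+1)) = (Multiset.card T : ℝ) := by
      have := Complex.ofReal_injective (h2.trans (Complex.ofReal_natCast _).symm)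
      simpa using this
    rw [← h3]
    gcongr
  have hint := int_of_trig _ T hT'
  set D := huaD N (j+1) φ A with hD
  have hc : Continuous (fun α => ‖huaS α (A.val.map φ)‖) := (huaS_cont _).norm
  have hcD := huaS_cont D
  have hcT := huaS_cont T
  have hre : ∫ α in (0:ℝ)..1, ‖huaS α (A.val.map φ)‖ ^ (2 ^ (j+1)) * (huaS α D).re =
      ((T.map (fun t => D.count (-t))).sum : ℕ) := by
    have h4 := huaS_int_mul T D
    have h5 : ∀ α, ‖huaS α (A.val.map φ)‖ ^ (2 ^ (j+1)) * (huaS α D).re =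
        Complex.reCLM (huaS α T * huaS α D) := by
      intro α
      rw [← hT', Complex.reCLM_apply, Complex.re_ofReal_mul]
    simp_rw [h5]
    have hcc : Continuous (fun α => huaS α T * huaS α D) := hcT.mul hcD
    rw [ContinuousLinearMap.intervalIntegral_comp_comm _ (hcc.intervalIntegrable _ _), h4,
      Complex.reCLM_apply, Complex.natCast_re]
  have hsum := sum_count_le T D c0 c1 h0 h1
  have hcre : Continuous (fun α => (huaS α D).re) := Complex.continuous_re.comp hcD
  calc ∫ α in (0:ℝ)..1, ‖huaS α (A.val.map φ)‖ ^ (2 ^ (j+2))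
      ≤ ∫ α in (0:ℝ)..1, (2 * N + 1 : ℝ) ^ (2 ^ (j+1) - (j+1) - 1) *
          (‖huaS α (A.val.map φ)‖ ^ (2 ^ (j+1)) * (huaS α D).re) := by
        apply intervalIntegral.integral_mono_on (by norm_num)
        · exact (hc.pow _).intervalIntegrable _ _
        · exact (continuous_const.mul ((hc.pow _).mul hcre)).intervalIntegrable _ _
        · intro α _
          have := huaD_weyl N j φ A hA α
          rw [show 2 ^ (j+2) = 2 ^ (j+1) + 2 ^ (j+1) by ring, pow_add, mul_left_comm]
          gcongr
    _ = (2 * N + 1 : ℝ) ^ (2 ^ (j+1) - (j+1) - 1) * ((T.map (fun t => D.count (-t))).sum : ℕ) := by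
        rw [intervalIntegral.integral_const_mul, hre]
    _ ≤ _ := by
        rw [hint]
        gcongr
        calc (((T.map (fun t => D.count (-t))).sum : ℕ) : ℝ)
            ≤ ((T.count 0 * c0 + Multiset.card T * c1 : ℕ) : ℝ) := by exact_mod_cast hsum
          _ ≤ _ := by push_cast; gcongr

lemma hua_c1 (k : ℕ) (ε : ℝ) (hε : 0 < ε) (j : ℕ) (hj : j < k) : ∃ M : ℝ, 0 ≤ M ∧ ∀ N : ℕ, 1 ≤ N →
    ∃ c1 : ℕ, (c1 : ℝ) ≤ M * (N:ℝ) ^ ε ∧ ∀ m, m ≠ 0 →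
      (huaD N j (fun x => x ^ k) (Finset.Icc 1 (N:ℤ))).count m ≤ c1 := by
  have hk : 0 < k := by omega
  set δ : ℝ := ε / (k * k) with hδ
  have hδ0 : 0 < δ := by positivity
  obtain ⟨C, hC1, hC⟩ := divisor_bound δ hδ0
  refine ⟨(2 * (C * ((2:ℝ) ^ j) ^ δ)) ^ j * k, by positivity, fun N hN => ?_⟩
  have hN1 : (1:ℝ) ≤ N := by exact_mod_cast hN
  set R : ℝ := (2 * (C * ((2:ℝ) ^ j * (N:ℝ) ^ k) ^ δ)) ^ j * k with hR
  have hR0 : 0 ≤ R := by positivity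
  refine ⟨⌊R⌋₊, (Nat.floor_le hR0).trans ?_, fun m hm => ?_⟩
  · have e1 : (((2:ℝ) ^ j * (N:ℝ) ^ k) ^ δ) = ((2:ℝ) ^ j) ^ δ * (N:ℝ) ^ (ε / k) := by
      rw [Real.mul_rpow (by positivity) (by positivity)]
      congr 1
      rw [← Real.rpow_natCast, ← Real.rpow_mul (by positivity)]
      congr 1
      rw [hδ]; field_simp
    have e2 : ((N:ℝ) ^ (ε / k)) ^ j ≤ (N:ℝ) ^ ε := by
      rw [← Real.rpow_natCast, ← Real.rpow_mul (by positivity)]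
      apply Real.rpow_le_rpow_of_exponent_le hN1
      have : (j:ℝ) ≤ k := by exact_mod_cast hj.le
      rw [div_mul_eq_mul_div, div_le_iff₀ (by positivity)]
      gcongr
    rw [hR, e1]
    calc _ = (2 * (C * ((2:ℝ) ^ j) ^ δ)) ^ j * k * ((N:ℝ) ^ (ε / k)) ^ j := by
          rw [← mul_assoc C, ← mul_assoc 2, mul_pow]; ring
      _ ≤ _ := by gcongr
  · by_cases hmem : m ∈ huaD N j (fun x => x ^ k) (Finset.Icc 1 (N:ℤ))
    · have hb := huaD_bd N j ((N:ℤ) ^ k) (fun x => x ^ k) (Finset.Icc 1 (N:ℤ)) (by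
        intro x hx
        rw [Finset.mem_Icc] at hx
        rw [abs_of_nonneg (by have := hx.1; positivity)]
        have : 0 ≤ x := by omega
        gcongr
        exact hx.2) m hmem
      have hc := count_ne N k m hm j (Polynomial.X ^ k) (by simpa using hj) (by simp) (Finset.Icc 1 (N:ℤ))
      simp only [Polynomial.eval_pow, Polynomial.eval_X] at hc
      refine hc.trans (Nat.le_floor ?_)
      have hm0 : m.natAbs ≠ 0 := by simpa using hm
      have hmb : (m.natAbs : ℝ) ≤ (2:ℝ) ^ j * (N:ℝ) ^ k := by
        have : (m.natAbs : ℤ) ≤ 2 ^ j * (N:ℤ) ^ k := by rwa [Int.natCast_natAbs]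
        exact_mod_cast this
      push_cast
      rw [hR]
      have := hC _ hm0
      gcongr
      refine this.trans ?_
      gcongr
    · rw [Multiset.count_eq_zero_of_notMem hmem]
      exact Nat.zero_le _

lemma hua_c0 (k : ℕ) (j : ℕ) (hj : j < k) (N : ℕ) :
    (huaD N j (fun x => x ^ k) (Finset.Icc 1 (N:ℤ))).count 0 ≤ (j + k) * (2 * N + 1) ^ j := by
  have hc := count_zero N k j (Polynomial.X ^ k) (by simpa using hj) (by simp) (Finset.Icc 1 (N:ℤ)) subset_rfl
  simpa only [Polynomial.eval_pow, Polynomial.eval_X] using hc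

lemma hua_main (k : ℕ) (hk : 2 ≤ k) (ε : ℝ) (hε : 0 < ε) (j : ℕ) : j + 1 ≤ k → ∃ C : ℝ, 0 ≤ C ∧
    ∀ N : ℕ, 1 ≤ N →
    ∫ α in (0:ℝ)..1, ‖huaS α ((Finset.Icc 1 (N:ℤ)).val.map (fun x => x ^ k))‖ ^ (2 ^ (j+1)) ≤
      C * ((N:ℝ) ^ (2 ^ (j+1) - (j+1)) * (N:ℝ) ^ ε) := by
  induction j with
  | zero =>
    intro _
    refine ⟨3 * (1 + k), by positivity, fun N hN => ?_⟩
    have hN1 : (1:ℝ) ≤ N := by exact_mod_cast hN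
    have h1 := int_of_trig (fun α => ‖huaS α ((Finset.Icc 1 (N:ℤ)).val.map (fun x => x ^ k))‖ ^ 2) _
      (fun α => huaD_sq N _ _ subset_rfl α)
    have h2 := hua_c0 k 1 (by omega) N
    have h3 : (1:ℝ) ≤ (N:ℝ) ^ ε := Real.one_le_rpow hN1 hε.le
    norm_num at h1 ⊢
    rw [h1]
    have h4 : ((huaD N 1 (fun x => x ^ k) (Finset.Icc 1 (N:ℤ))).count 0 : ℝ) ≤
        (1 + k) * (2 * N + 1) := by
      have : (((huaD N 1 (fun x => x ^ k) (Finset.Icc 1 (N:ℤ))).count 0 : ℕ) : ℝ) ≤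
        (((1 + k) * (2 * N + 1) ^ 1 : ℕ) : ℝ) := by exact_mod_cast h2
      simpa using this
    calc _ ≤ (1 + k : ℝ) * (2 * N + 1) := h4
      _ ≤ (1 + k : ℝ) * (3 * (N * (N:ℝ) ^ ε)) := by
          gcongr
          nlinarith
      _ = _ := by ring
  | succ j ih =>
    intro hj
    obtain ⟨C, hC0, hC⟩ := ih (by omega)
    obtain ⟨M, hM0, hM⟩ := hua_c1 k ε hε (j+1) (by omega)
    refine ⟨3 ^ (2 ^ (j+1) - (j+1) - 1) * (C * ((j + 1 + k) * 3 ^ (j+1)) + M), by positivity,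
      fun N hN => ?_⟩
    have hN1 : (1:ℝ) ≤ N := by exact_mod_cast hN
    obtain ⟨c1, hc1, hcc⟩ := hM N hN
    have hs := hua_step N j (fun x => x ^ k) (Finset.Icc 1 (N:ℤ)) subset_rfl _ c1
      (hua_c0 k (j+1) (by omega) N) hcc
    refine hs.trans ?_
    have h3 : (2 * N + 1 : ℝ) ≤ 3 * N := by linarith
    have hlt : j + 1 < 2 ^ (j+1) := Nat.lt_two_pow_self
    obtain ⟨a, ha⟩ : ∃ a, 2 ^ (j+1) = a + 1 + (j + 1) := ⟨2 ^ (j+1) - (j+1) - 1, by omega⟩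
    have e1 : 2 ^ (j+1) - (j+1) - 1 = a := by omega
    have e2 : 2 ^ (j+1) - (j+1) = a + 1 := by omega
    have e3 : 2 ^ (j+1+1) - (j+1+1) = a + (j + 1) + (a + 1) := by
      rw [pow_succ 2 (j+1)]; omega
    have hCN := hC N hN
    rw [e2] at hCN
    rw [e1, e3]
    push_cast
    have hI0 : 0 ≤ ∫ α in (0:ℝ)..1,
        ‖huaS α ((Finset.Icc 1 (N:ℤ)).val.map (fun x => x ^ k))‖ ^ (2 ^ (j+1)) :=
      intervalIntegral.integral_nonneg (by norm_num) (fun _ _ => by positivity)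
    calc _ ≤ (3 * N : ℝ) ^ a * ((C * ((N:ℝ) ^ (a + 1) * (N:ℝ) ^ ε)) *
            ((j + 1 + k) * (3 * N) ^ (j+1)) + (N:ℝ) ^ (2 ^ (j+1)) * (M * (N:ℝ) ^ ε)) := by
          gcongr
      _ = _ := by
          rw [ha]
          generalize (N:ℝ) ^ ε = y
          ring

theorem hua_inequality (k : ℕ) (hk : 2 ≤ k) (ε : ℝ) (hε : ε > 0) :
    ∃ C : ℝ, ∀ X : ℝ, X ≥ 1 →
      (∫ α in (0 : ℝ)..1, ‖gsum k α X‖ ^ (2 ^ k)) ≤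
        C * X ^ ((2 : ℝ) ^ k - k + ε) := by
  obtain ⟨C, hC0, hC⟩ := hua_main k hk ε hε (k - 1) (by omega)
  rw [Nat.sub_add_cancel (by omega)] at hC
  refine ⟨C, fun X hX => ?_⟩
  set N := ⌊X⌋₊ with hN
  have hN1 : 1 ≤ N := Nat.le_floor (by simpa using hX)
  have hNX : (N:ℝ) ≤ X := Nat.floor_le (by linarith)
  have hg : ∀ α, gsum k α X = huaS α ((Finset.Icc 1 (N:ℤ)).val.map (fun x => x ^ k)) := by
    intro α
    rw [huaS_apply, Multiset.map_map]
    change _ = ∑ x ∈ Finset.Icc 1 (N:ℤ), huaE α (x ^ k)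
    rw [gsum]
    refine Finset.sum_bij' (fun x _ => (x:ℤ)) (fun x _ => x.toNat) ?_ ?_ ?_ ?_ ?_
    · intro x hx
      rw [Finset.mem_Icc] at *
      omega
    · intro x hx
      rw [Finset.mem_Icc] at *
      omega
    · intro x hx; simp
    · intro x hx
      rw [Finset.mem_Icc] at hx
      exact Int.toNat_of_nonneg (by omega)
    · intro x hx
      simp [huaE]
  simp_rw [hg]
  refine (hC N hN1).trans ?_
  have hlt : k < 2 ^ k := Nat.lt_two_pow_self
  have hNp : (0:ℝ) < N := by exact_mod_cast hN1
  have hltr : (k:ℝ) < 2 ^ k := by exact_mod_cast hlt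
  rw [← Real.rpow_natCast, ← Real.rpow_add hNp, Nat.cast_sub hlt.le]
  push_cast
  gcongr
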